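/- Let X be a real-valued random variable on a probability space with E[X] = 0 and X ∈ [a, b] almost surely, where a < 0 < b and |a| ≥ b. Then for every real s > 0, E[exp(sX)] ≤ 2 · exp( (s²/4) · |a| · b ). -/

import Mathlib

open MeasureTheory Real ProbabilityTheory
open scoped ProbabilityTheory

/-- The chord of `exp (s * ·)` over `[a, b]` lies above the function. -/
lemma exp_mul_le_chord {a b s x : ℝ} (h : a < b) (hx : x ∈ Set.Icc a b) :
    exp (s * x) ≤ (b - x) / (b - a) * exp (s * a) + (x - a) / (b - a) * exp (s * b) := by
  have hd : 0 < b - a := sub_pos.2 h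
  have key := convexOn_exp.2 (Set.mem_univ (s * a)) (Set.mem_univ (s * b))
    (div_nonneg (sub_nonneg.2 hx.2) hd.le) (div_nonneg (sub_nonneg.2 hx.1) hd.le)
    (by field_simp; ring)
  simp only [smul_eq_mul] at key
  have hcomb : (b - x) / (b - a) * (s * a) + (x - a) / (b - a) * (s * b) = s * x := by
    field_simp
    ring
  rwa [hcomb] at key

lemma exp_mul_le_exp_div_mul_exp {A b : ℝ} (hA : 0 < A) (hb : 0 < b) (s : ℝ) :
    exp (s * b) ≤ exp (b / A) * exp (s ^ 2 / 4 * (A * b)) := by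
  rw [← exp_add, exp_le_exp]
  have h : b / A + s ^ 2 / 4 * (A * b) - s * b = b / A * (s * A / 2 - 1) ^ 2 := by
    field_simp
    ring
  have : 0 ≤ b / A * (s * A / 2 - 1) ^ 2 := by positivity
  linarith

lemma exp_le_two_add {u : ℝ} (h0 : 0 ≤ u) (h1 : u ≤ 1) : exp u ≤ 2 + u := by
  have h := (abs_le.1 (abs_exp_sub_one_sub_id_le (x := u) (by rwa [abs_of_nonneg h0]))).2
  nlinarith

lemma two_point_exp_le {A b s : ℝ} (hb : 0 < b) (hbA : b ≤ A) (hs : 0 ≤ s) :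
    b / (b + A) * exp (-(s * A)) + A / (b + A) * exp (s * b)
      ≤ 2 * exp (s ^ 2 / 4 * (A * b)) := by
  have hA : 0 < A := hb.trans_le hbA
  set G := exp (s ^ 2 / 4 * (A * b))
  have hG : 1 ≤ G := one_le_exp (by positivity)
  have h1 : exp (-(s * A)) ≤ G :=
    (exp_le_one_iff.2 (neg_nonpos.2 (by positivity))).trans hG
  have h2 : exp (s * b) ≤ (2 + b / A) * G :=
    (exp_mul_le_exp_div_mul_exp hA hb s).trans
      (by gcongr; exact exp_le_two_add (by positivity) ((div_le_one hA).2 hbA))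
  calc b / (b + A) * exp (-(s * A)) + A / (b + A) * exp (s * b)
      ≤ b / (b + A) * G + A / (b + A) * ((2 + b / A) * G) := by gcongr
    _ = 2 * G := by
      field_simp
      ring

theorem stmt_3 {Ω : Type*} [MeasureSpace Ω] [IsProbabilityMeasure (ℙ : Measure Ω)]
    (X : Ω → ℝ) (hX : Measurable X) (a b : ℝ) (ha : a < 0) (hb : 0 < b)
    (hab : b ≤ |a|)
    (hmem : ∀ᵐ ω, X ω ∈ Set.Icc a b) (hmean : ∫ ω, X ω = 0)
    (s : ℝ) (hs : 0 < s) :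
    ∫ ω, Real.exp (s * X ω) ≤ 2 * Real.exp (s ^ 2 / 4 * (|a| * b)) := by
  have hXint : Integrable X ℙ := Integrable.of_mem_Icc a b hX.aemeasurable hmem
  have hXint₁ : Integrable (fun ω => (b - X ω) / (b - a) * exp (s * a)) ℙ :=
    (((integrable_const b).sub hXint).div_const _).mul_const _
  have hXint₂ : Integrable (fun ω => (X ω - a) / (b - a) * exp (s * b)) ℙ :=
    ((hXint.sub (integrable_const a)).div_const _).mul_const _
  calc ∫ ω, exp (s * X ω)
      ≤ ∫ ω, ((b - X ω) / (b - a) * exp (s * a) + (X ω - a) / (b - a) * exp (s * b)) :=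
        integral_mono_of_nonneg (.of_forall fun _ => (exp_pos _).le) (hXint₁.add hXint₂)
          (hmem.mono fun _ h => exp_mul_le_chord (ha.trans hb) h)
    _ = b / (b + |a|) * exp (-(s * |a|)) + |a| / (b + |a|) * exp (s * b) := by
        rw [integral_add hXint₁ hXint₂, integral_mul_const, integral_mul_const,
          integral_div, integral_div, integral_sub (integrable_const b) hXint,
          integral_sub hXint (integrable_const a), hmean, abs_of_neg ha]
        simp [sub_eq_add_neg]
    _ ≤ 2 * exp (s ^ 2 / 4 * (|a| * b)) := two_point_exp_le hb hab hs.le
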